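/- arXiv:1302.2419 — 10 statements merged into one kernel-verified Lean document; each statement's English description precedes it below -/
import Mathlib

section
/- Let β ≠ 0 be a real constant and let y : I → ℝ be a twice differentiable function on an open interval I with y(x) > 0 for all x ∈ I, satisfying the Painlevé 34 equation y'' = y'²/(2y) − 2y² − x·y − β²/(2y) on I. Define ỹ on the interval Ĩ = {x/β^{2/3} : x ∈ I} by ỹ(x̃) = y(β^{2/3}·x̃)³/β². Then ỹ is twice differentiable, positive, and satisfies the scaled Painlevé 34 equation ỹ'' = 5·ỹ'²/(6ỹ) − β²·ỹ^{1/3}·(6ỹ + 3x̃·ỹ^{2/3} + 3/2) on Ĩ. -/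
/-- if `y` is a positive solution of the Painlevé 34 equation
`y'' = y'²/(2y) − 2y² − x·y − β²/(2y)` (`β ≠ 0`) on an open interval, then
`ỹ(x̃) = y(β^{2/3}·x̃)³/β²` is a positive solution of the scaled Painlevé 34 equation
`ỹ'' = 5ỹ'²/(6ỹ) − β²·ỹ^{1/3}(6ỹ + 3x̃·ỹ^{2/3} + 3/2)` on the rescaled interval. -/
theorem painleve34_scaling (β : ℝ) (hβ : β ≠ 0) (a b : ℝ) (y y' y'' : ℝ → ℝ)
    (hy : ∀ x ∈ Set.Ioo a b, HasDerivAt y (y' x) x)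
    (hy' : ∀ x ∈ Set.Ioo a b, HasDerivAt y' (y'' x) x)
    (hpos : ∀ x ∈ Set.Ioo a b, 0 < y x)
    (hode : ∀ x ∈ Set.Ioo a b,
      y'' x = (y' x) ^ 2 / (2 * y x) - 2 * (y x) ^ 2 - x * y x - β ^ 2 / (2 * y x)) :
    let c : ℝ := (β ^ 2) ^ ((1:ℝ)/3)
    let z : ℝ → ℝ := fun t => (y (c * t)) ^ 3 / β ^ 2
    ∃ z' z'' : ℝ → ℝ, ∀ t ∈ (fun x => x / c) '' Set.Ioo a b,
      HasDerivAt z (z' t) t ∧ HasDerivAt z' (z'' t) t ∧ 0 < z t ∧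
      z'' t = 5 * (z' t) ^ 2 / (6 * z t)
        - β ^ 2 * (z t) ^ ((1:ℝ)/3) * (6 * z t + 3 * t * (z t) ^ ((2:ℝ)/3) + 3 / 2) := by
  intro c z
  have hb : 0 < β ^ 2 := by positivity
  have hc : 0 < c := Real.rpow_pos_of_pos hb _
  have hc3 : β ^ 2 = c ^ 3 := by
    change β ^ 2 = ((β ^ 2) ^ ((1:ℝ)/3)) ^ 3
    rw [← Real.rpow_natCast _ 3, ← Real.rpow_mul hb.le]
    norm_num
  refine ⟨fun t => 3 * (y (c * t)) ^ 2 * (y' (c * t) * c) / β ^ 2,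
    fun t => (3 * (2 * y (c * t) * (y' (c * t) * c)) * (y' (c * t) * c)
      + 3 * (y (c * t)) ^ 2 * (y'' (c * t) * c * c)) / β ^ 2, ?_⟩
  rintro t ⟨x, hx, hxt⟩
  have hct : c * t = x := by
    rw [← hxt]
    field_simp
  have hlin : HasDerivAt (fun t : ℝ => c * t) c t := by
    simpa using (hasDerivAt_id t).const_mul c
  have hx' : c * t ∈ Set.Ioo a b := by rw [hct]; exact hx
  have h1 : HasDerivAt (fun t => y (c * t)) (y' (c * t) * c) t :=
    HasDerivAt.comp t (hy _ hx') hlin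
  have h2 : HasDerivAt (fun t => y' (c * t)) (y'' (c * t) * c) t :=
    HasDerivAt.comp t (hy' _ hx') hlin
  have hY := hpos _ hx'
  have hO := hode _ hx'
  have hz : z t = (y (c * t) / c) ^ 3 := by
    change (y (c * t)) ^ 3 / β ^ 2 = _
    rw [hc3, div_pow]
  have hq : 0 < y (c * t) / c := div_pos hY hc
  have hz1 : (z t) ^ ((1:ℝ)/3) = y (c * t) / c := by
    rw [hz, ← Real.rpow_natCast, ← Real.rpow_mul hq.le]
    norm_num
  have hz2 : (z t) ^ ((2:ℝ)/3) = (y (c * t) / c) ^ 2 := by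
    rw [hz, ← Real.rpow_natCast, ← Real.rpow_mul hq.le, ← Real.rpow_natCast]
    norm_num
  refine ⟨?_, ?_, ?_, ?_⟩
  · have h := (h1.pow 3).div_const (β ^ 2)
    exact HasDerivAt.congr_deriv h (by norm_num)
  · have h := (((h1.pow 2).const_mul 3).mul (h2.mul_const c)).div_const (β ^ 2)
    exact HasDerivAt.congr_deriv h (by norm_num)
  · rw [hz]; positivity
  · rw [hz1, hz2, hz]
    beta_reduce
    rw [hO, hc3]
    generalize y (c * t) = Y at *
    generalize y' (c * t) = P at *
    field_simp
    ring
end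

section
/- Let w : J → ℝ be a twice differentiable function on an open interval J with w(x̃) ≠ 0 for all x̃ ∈ J, satisfying the Painlevé II equation w'' = 2w³ + x̃·w (parameter a = 0) on J. Define y on the interval I = {−2^{1/3}·x̃ : x̃ ∈ J} by y(x) = −2^{1/3}·w(−2^{−1/3}·x)². Then y is twice differentiable, nowhere zero, and satisfies the Painlevé 34 equation with zero parameter, y'' = y'²/(2y) − 2y² − x·y, on I. -/
/-- if `w` is a nowhere-zero solution of the Painlevé II equation
`w'' = 2w³ + x̃·w` (parameter `a = 0`) on an open interval, then
`y(x) = −2^{1/3}·w(−2^{−1/3}·x)²` is a nowhere-zero solution of the Painlevé 34 equation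
with zero parameter, `y'' = y'²/(2y) − 2y² − x·y`, on the interval `{−2^{1/3}·x̃}`. -/
theorem painleveII_to_painleve34 (c d : ℝ) (w w' w'' : ℝ → ℝ)
    (hw : ∀ t ∈ Set.Ioo c d, HasDerivAt w (w' t) t)
    (hw' : ∀ t ∈ Set.Ioo c d, HasDerivAt w' (w'' t) t)
    (hne : ∀ t ∈ Set.Ioo c d, w t ≠ 0)
    (hode : ∀ t ∈ Set.Ioo c d, w'' t = 2 * (w t) ^ 3 + t * w t) :
    let r : ℝ := (2:ℝ) ^ ((1:ℝ)/3)
    let y : ℝ → ℝ := fun x => -r * (w (-((2:ℝ) ^ (-(1:ℝ)/3)) * x)) ^ 2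
    ∃ y' y'' : ℝ → ℝ, ∀ x ∈ (fun t => -r * t) '' Set.Ioo c d,
      HasDerivAt y (y' x) x ∧ HasDerivAt y' (y'' x) x ∧ y x ≠ 0 ∧
      y'' x = (y' x) ^ 2 / (2 * y x) - 2 * (y x) ^ 2 - x * y x := by
  intro r y
  have hr : 0 < r := by positivity
  have hr3 : r ^ 3 = 2 := by
    change ((2:ℝ) ^ ((1:ℝ)/3)) ^ 3 = 2
    rw [← Real.rpow_natCast, ← Real.rpow_mul (by norm_num)]
    norm_num
  have hs : (2:ℝ) ^ (-(1:ℝ)/3) = r⁻¹ := by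
    change _ = ((2:ℝ) ^ ((1:ℝ)/3))⁻¹
    rw [← Real.rpow_neg (by norm_num)]
    norm_num
  have hy : y = fun x => -r * (w (-r⁻¹ * x)) ^ 2 := by
    funext x
    change -r * (w (-((2:ℝ) ^ (-(1:ℝ)/3)) * x)) ^ 2 = _
    rw [hs]
  clear_value y r
  subst hy
  refine ⟨fun x => 2 * w (-r⁻¹ * x) * w' (-r⁻¹ * x),
    fun x => -2 * r⁻¹ * (w' (-r⁻¹ * x) ^ 2 + w (-r⁻¹ * x) * w'' (-r⁻¹ * x)), ?_⟩
  rintro x ⟨t, ht, rfl⟩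
  have hr0 : r ≠ 0 := hr.ne'
  have e : -r⁻¹ * (-r * t) = t := by field_simp
  have hl : HasDerivAt (fun x : ℝ => -r⁻¹ * x) (-r⁻¹) (-r * t) := by
    simpa using (hasDerivAt_id (-r * t)).const_mul (-r⁻¹)
  have h1 : HasDerivAt (fun x : ℝ => w (-r⁻¹ * x)) (w' t * -r⁻¹) (-r * t) :=
    HasDerivAt.comp (h₂ := w) (-r * t) (by rw [e]; exact hw t ht) hl
  have h2 : HasDerivAt (fun x : ℝ => w' (-r⁻¹ * x)) (w'' t * -r⁻¹) (-r * t) :=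
    HasDerivAt.comp (h₂ := w') (-r * t) (by rw [e]; exact hw' t ht) hl
  have hwt := hne t ht
  refine ⟨?_, ?_, ?_, ?_⟩
  · refine ((h1.pow 2).const_mul (-r)).congr_deriv ?_
    simp only [e]
    field_simp
    norm_num
    ring
  · refine ((h1.const_mul 2).mul h2).congr_deriv ?_
    simp only [e]
    ring
  · simp only [e]
    exact mul_ne_zero (neg_ne_zero.mpr hr0) (pow_ne_zero 2 hwt)
  · simp only [e]
    rw [hode t ht]
    field_simp
    ring_nf
    try rw [hr3]
    try ring
end

section
/- Let a > 0 be a real constant and let y : I → ℝ be a twice differentiable function on an open interval I with y(x) < 0 for all x ∈ I, satisfying equation XXXIV of Ince's list: y'' = y'²/(2y) + 4a·y² − x·y − 1/(2y) on I. Define ỹ on the interval Ĩ = {x/(2a)^{2/3} : x ∈ I} by ỹ(x̃) = −2a·y((2a)^{2/3}·x̃)³. Then ỹ is twice differentiable, positive, and satisfies the scaled Painlevé 34 equation ỹ'' = 5ỹ'²/(6ỹ) − β²·ỹ^{1/3}(6ỹ + 3x̃·ỹ^{2/3} + 3/2) with parameter β² = 4a². -/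
/-- if `y` is a negative solution of Ince's equation XXXIV
`y'' = y'²/(2y) + 4a·y² − x·y − 1/(2y)` (`a > 0`) on an open interval, then
`ỹ(x̃) = −2a·y((2a)^{2/3}·x̃)³` is a positive solution of the scaled Painlevé 34 equation
with parameter `β² = 4a²` on the rescaled interval. -/
theorem ince34_to_scaled_painleve34 (a : ℝ) (ha : 0 < a) (p q : ℝ) (y y' y'' : ℝ → ℝ)
    (hy : ∀ x ∈ Set.Ioo p q, HasDerivAt y (y' x) x)
    (hy' : ∀ x ∈ Set.Ioo p q, HasDerivAt y' (y'' x) x)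
    (hneg : ∀ x ∈ Set.Ioo p q, y x < 0)
    (hode : ∀ x ∈ Set.Ioo p q,
      y'' x = (y' x) ^ 2 / (2 * y x) + 4 * a * (y x) ^ 2 - x * y x - 1 / (2 * y x)) :
    let c : ℝ := ((2 * a) ^ 2) ^ ((1:ℝ)/3)
    let z : ℝ → ℝ := fun t => -2 * a * (y (c * t)) ^ 3
    ∃ z' z'' : ℝ → ℝ, ∀ t ∈ (fun x => x / c) '' Set.Ioo p q,
      HasDerivAt z (z' t) t ∧ HasDerivAt z' (z'' t) t ∧ 0 < z t ∧
      z'' t = 5 * (z' t) ^ 2 / (6 * z t)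
        - 4 * a ^ 2 * (z t) ^ ((1:ℝ)/3) * (6 * z t + 3 * t * (z t) ^ ((2:ℝ)/3) + 3 / 2) := by
  intro c z
  obtain ⟨k, hk, hka⟩ : ∃ k : ℝ, 0 < k ∧ k ^ 3 = 2 * a := by
    refine ⟨(2 * a) ^ ((1:ℝ)/3), by positivity, ?_⟩
    rw [← Real.rpow_natCast, ← Real.rpow_mul (by positivity)]
    norm_num
  have cube : ∀ w : ℝ, 0 < w → (w ^ 3) ^ ((1:ℝ)/3) = w := by
    intro w hw
    rw [← Real.rpow_natCast, ← Real.rpow_mul hw.le]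
    norm_num
  have cube2 : ∀ w : ℝ, 0 < w → (w ^ 3) ^ ((2:ℝ)/3) = w ^ 2 := by
    intro w hw
    rw [← Real.rpow_natCast, ← Real.rpow_mul hw.le, ← Real.rpow_natCast]
    norm_num
  have hc : c = k ^ 2 := by
    change ((2 * a) ^ 2) ^ ((1:ℝ)/3) = k ^ 2
    rw [← hka, show (k ^ 3) ^ 2 = (k ^ 2) ^ 3 by ring]
    exact cube _ (by positivity)
  have hcpos : 0 < c := by rw [hc]; positivity
  have hak : a = k ^ 3 / 2 := by linarith
  clear_value c
  refine ⟨fun t => -6 * a * c * ((y (c * t)) ^ 2 * y' (c * t)),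
    fun t => -6 * a * c * (c * (2 * y (c * t) * (y' (c * t)) ^ 2
      + (y (c * t)) ^ 2 * y'' (c * t))), ?_⟩
  rintro t ⟨x, hx, rfl⟩
  have hcx : c * (x / c) = x := by field_simp
  have hlin : HasDerivAt (fun t : ℝ => c * t) c (x / c) := by
    simpa using (hasDerivAt_id (x / c)).const_mul c
  have h1 : HasDerivAt (fun t => y (c * t)) (y' x * c) (x / c) := by
    have h := hy x hx
    rw [← hcx] at h
    have := HasDerivAt.comp (x / c) h hlin
    rw [hcx] at this
    exact this
  have h2 : HasDerivAt (fun t => y' (c * t)) (y'' x * c) (x / c) := by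
    have h := hy' x hx
    rw [← hcx] at h
    have := HasDerivAt.comp (x / c) h hlin
    rw [hcx] at this
    exact this
  have hn := hneg x hx
  have hne : y x ≠ 0 := hn.ne
  have hz : z (x / c) = (k * (-y x)) ^ 3 := by
    change -2 * a * (y (c * (x / c))) ^ 3 = _
    rw [hcx, hak]; ring
  have hw : 0 < k * (-y x) := mul_pos hk (by linarith)
  refine ⟨?_, ?_, ?_, ?_⟩
  · refine ((h1.pow 3).const_mul (-2 * a)).congr_deriv ?_
    simp only [hcx]; push_cast; ring
  · refine (((h1.pow 2).mul h2).const_mul (-6 * a * c)).congr_deriv ?_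
    simp only [hcx, Pi.pow_apply]; push_cast; ring
  · rw [hz]; positivity
  · rw [hz, cube _ hw, cube2 _ hw]
    simp only [hcx]
    rw [hode x hx, hak, hc]
    field_simp
    ring
end

section
/- Let ν₁ ≠ 0, C ≠ 0, K be real constants, let k₂ > 0 and k₁ ≠ 0, and let w : I → ℝ be a twice differentiable function on an open interval I with k₁·w(x)³ < 0 for all x ∈ I, satisfying the 3-ion electrodiffusion equation w'' − w'²/(2w) + ν₁²·(−2k₁·w² − (C·x+K)·w + k₂/w) = 0 on I. Define x̃(x) = −(C·x+K)/(2^{1/3}·k₁^{2/3}·k₂^{1/3}) (an invertible affine map, where k₁^{2/3} = (k₁²)^{1/3} > 0) and set ỹ(x̃(x)) = −k₁·w(x)³/(2k₂). Then ỹ, as a function of x̃, is twice differentiable, positive, and satisfies the scaled Painlevé 34 equation ỹ'' = 5ỹ'²/(6ỹ) − β²·ỹ^{1/3}(6ỹ + 3x̃·ỹ^{2/3} + 3/2) with parameter β² = 2k₂·ν₁²·k₁²/C². -/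
/-- the 3-ion electrodiffusion equation (case 3a)
`w'' − w'²/(2w) + ν₁²(−2k₁w² − (Cx+K)w + k₂/w) = 0` with `ν₁ ≠ 0`, `C ≠ 0`, `k₁ ≠ 0`,
`k₂ > 0` and `k₁·w³ < 0` is transformed by
`x̃ = −(Cx+K)/(2^{1/3}k₁^{2/3}k₂^{1/3})`, `ỹ = −k₁w³/(2k₂)` into the scaled Painlevé 34
equation with parameter `β² = 2k₂ν₁²k₁²/C²`. -/
theorem threeIon3a_to_scaled_painleve34 (ν₁ C K k₁ k₂ : ℝ)
    (hν : ν₁ ≠ 0) (hC : C ≠ 0) (hk₁ : k₁ ≠ 0) (hk₂ : 0 < k₂)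
    (a b : ℝ) (w w' w'' : ℝ → ℝ)
    (hw : ∀ x ∈ Set.Ioo a b, HasDerivAt w (w' x) x)
    (hw' : ∀ x ∈ Set.Ioo a b, HasDerivAt w' (w'' x) x)
    (hneg : ∀ x ∈ Set.Ioo a b, k₁ * (w x) ^ 3 < 0)
    (hode : ∀ x ∈ Set.Ioo a b,
      w'' x - (w' x) ^ 2 / (2 * w x)
        + ν₁ ^ 2 * (-2 * k₁ * (w x) ^ 2 - (C * x + K) * w x + k₂ / w x) = 0) :
    let dcoef : ℝ := (2:ℝ) ^ ((1:ℝ)/3) * (k₁ ^ 2) ^ ((1:ℝ)/3) * k₂ ^ ((1:ℝ)/3)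
    let xt : ℝ → ℝ := fun x => -(C * x + K) / dcoef
    let z : ℝ → ℝ := fun t => -k₁ * (w ((-(dcoef * t) - K) / C)) ^ 3 / (2 * k₂)
    ∃ z' z'' : ℝ → ℝ, ∀ t ∈ xt '' Set.Ioo a b,
      HasDerivAt z (z' t) t ∧ HasDerivAt z' (z'' t) t ∧ 0 < z t ∧
      z'' t = 5 * (z' t) ^ 2 / (6 * z t)
        - (2 * k₂ * ν₁ ^ 2 * k₁ ^ 2 / C ^ 2) * (z t) ^ ((1:ℝ)/3)
          * (6 * z t + 3 * t * (z t) ^ ((2:ℝ)/3) + 3 / 2) := by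
  intro d xt z
  have hd : 0 < d := by
    have h1 : 0 < k₁ ^ 2 := by positivity
    simp only [d]
    positivity
  have hd3 : d ^ 3 = 2 * k₁ ^ 2 * k₂ := by
    have key : ∀ u : ℝ, 0 ≤ u → (u ^ ((1:ℝ)/3)) ^ 3 = u := by
      intro u hu
      rw [← Real.rpow_natCast, ← Real.rpow_mul hu]
      norm_num
    simp only [d]
    rw [mul_pow, mul_pow, key _ (by norm_num), key _ (by positivity), key _ hk₂.le]
  clear_value d
  refine ⟨fun t => -k₁ * (3 * (w ((-(d * t) - K) / C)) ^ 2 * (w' ((-(d * t) - K) / C) * (-d / C))) / (2 * k₂),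
    fun t => -k₁ * (6 * (w ((-(d * t) - K) / C)) * (w' ((-(d * t) - K) / C) * (-d / C)) ^ 2
      + 3 * (w ((-(d * t) - K) / C)) ^ 2 * (w'' ((-(d * t) - K) / C) * (-d / C) ^ 2)) / (2 * k₂), ?_⟩
  rintro t ⟨x, hx, hxt⟩
  have hCx : C * x + K = -(d * t) := by
    rw [← hxt]; simp only [xt]; field_simp
  have hX : (-(d * t) - K) / C = x := by
    rw [← hCx]; field_simp; ring
  have hL : HasDerivAt (fun t : ℝ => (-(d * t) - K) / C) (-d / C) t := by
    have := ((((hasDerivAt_id t).const_mul d).neg).sub_const K).div_const C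
    simpa using this
  have hW : HasDerivAt (fun t => w ((-(d * t) - K) / C)) (w' x * (-d / C)) t := by
    have h := hw x hx
    rw [← hX] at h
    have := h.comp t hL
    rw [hX] at this
    exact this
  have hW' : HasDerivAt (fun t => w' ((-(d * t) - K) / C)) (w'' x * (-d / C)) t := by
    have h := hw' x hx
    rw [← hX] at h
    have := h.comp t hL
    rw [hX] at this
    exact this
  have hn := hneg x hx
  have ho := hode x hx
  have hw0 : w x ≠ 0 := by
    intro h; rw [h] at hn; norm_num at hn
  have hkw : k₁ * w x < 0 := by
    have h2 : 0 < w x ^ 2 := by positivity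
    by_contra hcon
    push Not at hcon
    nlinarith [mul_nonneg hcon h2.le]
  have hzt : z t = -k₁ * (w x) ^ 3 / (2 * k₂) := by simp only [z, hX]
  obtain ⟨s, hs⟩ : ∃ s, s = -(k₁ * w x) / d := ⟨_, rfl⟩
  have hs0 : 0 < s := by rw [hs]; exact div_pos (by linarith) hd
  have hzs : z t = s ^ 3 := by
    rw [hzt, hs, div_pow, hd3]; field_simp
  have hr1 : (z t) ^ ((1:ℝ)/3) = s := by
    rw [hzs, ← Real.rpow_natCast, ← Real.rpow_mul hs0.le]; norm_num
  have hr2 : (z t) ^ ((2:ℝ)/3) = s ^ 2 := by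
    rw [hzs, ← Real.rpow_natCast, ← Real.rpow_mul hs0.le, ← Real.rpow_natCast]; norm_num
  refine ⟨?_, ?_, by rw [hzs]; positivity, ?_⟩
  · have := ((hW.fun_pow 3).const_mul (-k₁)).div_const (2 * k₂)
    refine this.congr_deriv ?_
    simp only [hX]; norm_num
  · have := ((((hW.fun_pow 2).const_mul 3).fun_mul (hW'.mul_const (-d / C))).const_mul (-k₁)).div_const (2 * k₂)
    refine this.congr_deriv ?_
    simp only [hX]; norm_num; ring
  · rw [hr1, hr2, hzt]
    simp only [hX]
    have hw2 : w'' x = (w' x) ^ 2 / (2 * w x)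
        + ν₁ ^ 2 * (2 * k₁ * (w x) ^ 2 - d * t * w x - k₂ / w x) := by
      rw [hCx] at ho; linear_combination ho
    have hk2 : k₂ = d ^ 3 / (2 * k₁ ^ 2) := by rw [hd3]; field_simp
    have hd0 := hd.ne'
    rw [hw2, hs, hk2]
    field_simp
    ring
end

section
/- Let ν₁ ≠ 0, k₁ ≠ 0, C ≠ 0, K be real constants and let w : I → ℝ be a twice differentiable function on an open interval I with k₁·w(x) + C·x + K < 0 for all x ∈ I, satisfying the 3-ion electrodiffusion equation (case 3b): (w + (C·x+K)/k₁)·w'' − w'²/2 − C·w'/k₁ − 2k₁·ν₁²·w³ − 4ν₁²·(C·x+K)·w² − 2ν₁²·(C·x+K)²·w/k₁ = 0 on I. Define x̃(x) = 2ν₁^{2/3}·(C·x+K)/C^{2/3} (an invertible affine map, where ν₁^{2/3} = (ν₁²)^{1/3} and C^{2/3} = (C²)^{1/3}) and set ỹ(x̃(x)) = −ν₁²·(k₁·w(x) + C·x + K)³/C². Then ỹ, as a function of x̃, is twice differentiable, positive, and satisfies the scaled Painlevé 34 equation ỹ'' = 5ỹ'²/(6ỹ) − β²·ỹ^{1/3}(6ỹ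 + 3x̃·ỹ^{2/3} + 3/2) with parameter β² = 1/4. -/
/-- the 3-ion electrodiffusion equation (case 3b)
`(w + (Cx+K)/k₁)w'' − w'²/2 − Cw'/k₁ − 2k₁ν₁²w³ − 4ν₁²(Cx+K)w² − 2ν₁²(Cx+K)²w/k₁ = 0`
with `ν₁ ≠ 0`, `k₁ ≠ 0`, `C ≠ 0` and `k₁w + Cx + K < 0` is transformed by
`x̃ = 2ν₁^{2/3}(Cx+K)/C^{2/3}`, `ỹ = −ν₁²(k₁w + Cx + K)³/C²` into the scaled
Painlevé 34 equation with parameter `β² = 1/4`. -/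
theorem threeIon3b_to_scaled_painleve34 (ν₁ k₁ C K : ℝ)
    (hν : ν₁ ≠ 0) (hk : k₁ ≠ 0) (hC : C ≠ 0)
    (a b : ℝ) (w w' w'' : ℝ → ℝ)
    (hw : ∀ x ∈ Set.Ioo a b, HasDerivAt w (w' x) x)
    (hw' : ∀ x ∈ Set.Ioo a b, HasDerivAt w' (w'' x) x)
    (hneg : ∀ x ∈ Set.Ioo a b, k₁ * w x + C * x + K < 0)
    (hode : ∀ x ∈ Set.Ioo a b,
      (w x + (C * x + K) / k₁) * w'' x - (w' x) ^ 2 / 2 - C * w' x / k₁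
        - 2 * k₁ * ν₁ ^ 2 * (w x) ^ 3 - 4 * ν₁ ^ 2 * (C * x + K) * (w x) ^ 2
        - 2 * ν₁ ^ 2 * (C * x + K) ^ 2 * w x / k₁ = 0) :
    let e : ℝ := (ν₁ ^ 2) ^ ((1:ℝ)/3)
    let f : ℝ := (C ^ 2) ^ ((1:ℝ)/3)
    let xt : ℝ → ℝ := fun x => 2 * e * (C * x + K) / f
    let z : ℝ → ℝ := fun t =>
      -ν₁ ^ 2 * (k₁ * w ((t * f / (2 * e) - K) / C) + t * f / (2 * e)) ^ 3 / C ^ 2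
    ∃ z' z'' : ℝ → ℝ, ∀ t ∈ xt '' Set.Ioo a b,
      HasDerivAt z (z' t) t ∧ HasDerivAt z' (z'' t) t ∧ 0 < z t ∧
      z'' t = 5 * (z' t) ^ 2 / (6 * z t)
        - (1 / 4) * (z t) ^ ((1:ℝ)/3) * (6 * z t + 3 * t * (z t) ^ ((2:ℝ)/3) + 3 / 2) := by
  intro e f xt z
  have he : 0 < e := Real.rpow_pos_of_pos (by positivity) _
  have hf : 0 < f := Real.rpow_pos_of_pos (by positivity) _
  have he3 : e ^ 3 = ν₁ ^ 2 := by
    show ((ν₁ ^ 2) ^ ((1:ℝ)/3)) ^ 3 = _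
    rw [← Real.rpow_natCast, ← Real.rpow_mul (by positivity)]; norm_num
  have hf3 : f ^ 3 = C ^ 2 := by
    show ((C ^ 2) ^ ((1:ℝ)/3)) ^ 3 = _
    rw [← Real.rpow_natCast, ← Real.rpow_mul (by positivity)]; norm_num
  clear_value e f
  let X : ℝ → ℝ := fun t => (t * f / (2 * e) - K) / C
  let U : ℝ → ℝ := fun t => k₁ * w (X t) + t * f / (2 * e)
  let P : ℝ → ℝ := fun t => k₁ * (w' (X t) * (f / (2 * e) / C)) + f / (2 * e)
  let Q : ℝ → ℝ := fun t => k₁ * (w'' (X t) * (f / (2 * e) / C) * (f / (2 * e) / C))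
  refine ⟨fun t => -ν₁ ^ 2 * (3 * U t ^ 2 * P t) / C ^ 2,
    fun t => -ν₁ ^ 2 * (3 * (2 * U t * P t) * P t + 3 * U t ^ 2 * Q t) / C ^ 2, ?_⟩
  rintro t ⟨x, hx, rfl⟩
  have hs : xt x * f / (2 * e) = C * x + K := by
    simp only [xt]; field_simp
  have hX : X (xt x) = x := by
    simp only [X]; rw [hs]; field_simp; ring
  have hlin : HasDerivAt (fun t : ℝ => t * f / (2 * e)) (f / (2 * e)) (xt x) := by
    simpa using ((hasDerivAt_id (xt x)).mul_const f).div_const (2 * e)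
  have hXd : HasDerivAt X (f / (2 * e) / C) (xt x) := (hlin.sub_const K).div_const C
  have hwX : HasDerivAt (fun t => w (X t)) (w' (X (xt x)) * (f / (2 * e) / C)) (xt x) :=
    HasDerivAt.comp (xt x) (by rw [hX]; exact hw x hx) hXd
  have hwX' : HasDerivAt (fun t => w' (X t)) (w'' (X (xt x)) * (f / (2 * e) / C)) (xt x) :=
    HasDerivAt.comp (xt x) (by rw [hX]; exact hw' x hx) hXd
  have hU : HasDerivAt U (P (xt x)) (xt x) := (hwX.const_mul k₁).add hlin
  have hP : HasDerivAt P (Q (xt x)) (xt x) :=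
    ((hwX'.mul_const (f / (2 * e) / C)).const_mul k₁).add_const _
  have hz : z = fun t => -ν₁ ^ 2 * U t ^ 3 / C ^ 2 := rfl
  have hUx : U (xt x) = k₁ * w x + (C * x + K) := by simp only [U]; rw [hX, hs]
  have hPx : P (xt x) = k₁ * (w' x * (f / (2 * e) / C)) + f / (2 * e) := by
    simp only [P]; rw [hX]
  have hQx : Q (xt x) = k₁ * (w'' x * (f / (2 * e) / C) * (f / (2 * e) / C)) := by
    simp only [Q]; rw [hX]
  have hUn : U (xt x) < 0 := by rw [hUx]; linarith [hneg x hx]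
  have hg : 0 < -(e / f) * U (xt x) := by
    have : 0 < e / f := by positivity
    nlinarith
  have hzg : z (xt x) = (-(e / f) * U (xt x)) ^ 3 := by
    rw [hz]; simp only; rw [← he3, ← hf3]; field_simp
  have ht : xt x = 2 * e * (C * x + K) / f := rfl
  have h1 : (z (xt x)) ^ ((1:ℝ)/3) = -(e / f) * U (xt x) := by
    rw [hzg, ← Real.rpow_natCast, ← Real.rpow_mul hg.le]; norm_num
  have h2 : (z (xt x)) ^ ((2:ℝ)/3) = (-(e / f) * U (xt x)) ^ 2 := by
    rw [hzg, ← Real.rpow_natCast, ← Real.rpow_mul hg.le, ← Real.rpow_natCast]; norm_num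
  refine ⟨?_, ?_, ?_, ?_⟩
  · rw [hz]
    simpa using ((hU.pow 3).const_mul (-ν₁ ^ 2)).div_const (C ^ 2)
  · have := (((((hU.pow 2).const_mul 3).mul hP)).const_mul (-ν₁ ^ 2)).div_const (C ^ 2)
    refine HasDerivAt.congr_deriv (f := fun t => -ν₁ ^ 2 * (3 * U t ^ 2 * P t) / C ^ 2) this ?_
    simp [Pi.pow_apply]
  · rw [hzg]; positivity
  · rw [h1, h2, hzg]
    have ho := hode x hx
    simp only
    have hW : w x = (U (xt x) - (C * x + K)) / k₁ := by rw [hUx]; field_simp; ring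
    have hW1 : w' x = (P (xt x) * (2 * e) / f * C - C) / k₁ := by
      rw [hPx]; field_simp; ring
    have hW2 : w'' x = Q (xt x) * (2 * e / f * C) ^ 2 / k₁ := by
      rw [hQx]; field_simp
    rw [hW, hW1, hW2] at ho
    clear hW hW1 hW2 h1 h2 hzg hUx hPx hQx hU hP
    generalize U (xt x) = u at *
    generalize P (xt x) = p at *
    generalize Q (xt x) = q at *
    rw [ht]
    clear hs ht
    generalize C * x + K = s at *
    have key : u * q = p ^ 2 / 2 - f ^ 2 / (8 * e ^ 2) + e * f ^ 2 * u ^ 2 * (u - s) / (2 * C ^ 2) := by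
      rw [← he3] at ho
      field_simp at ho ⊢
      linear_combination 2 * ho
    have hu : u ≠ 0 := hUn.ne
    rw [← he3, ← hf3]
    rw [← hf3] at key
    have hq : q = (p ^ 2 / 2 - f ^ 2 / (8 * e ^ 2) + e * f ^ 2 * u ^ 2 * (u - s) / (2 * f ^ 3)) / u := by
      rw [← key]; field_simp
    rw [hq]
    field_simp
    ring
end

section
/- Let β be a real constant and on {(x,y) : y ≠ 0, A(x,y) ≠ 0} consider the Painlevé 34 coefficients P = −2y² − xy − β²/(2y), Q = 0, R = 1/(6y), S = 0, with A, B, G, H defined by the standard formulas (so A = −3 − 3β²/(8y³), B = 0). Then: (i) the pseudoinvariant Ω = 2B·A_{1.0}(B·P + A_{1.0})/A³ − (2B_{1.0} + 3B·Q)A_{1.0}/A² + (A_{0.1} − 2B_{1.0})B·P/A² − (B·A_{2.0} + B²·P_{1.0})/A² + B_{2.0}/A + (3B_{1.0}·Q + 3B·Q_{1.0} − B_{0.1}·P − B·P_{0.1})/A + Q_{0.1} − 2R_{1.0} vanishes identically; (ii) N = −H/(3A) equals 5β²/(4y⁴) − 1/(2y); (iii) M = −12B·N(B·P + A_{1.0})/(5A)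 + (24/5)B·N·Q + (6/5)N·B_{1.0} + (6/5)N·A_{0.1} − A·N_{0.1} + B·N_{1.0} − (12/5)A·N·R equals 9/(10y²) − 63β²/(4y⁵). -/
noncomputable section

noncomputable section

/-- Partial derivative in the first (`x`) variable. -/
def pdx (f : ℝ → ℝ → ℝ) : ℝ → ℝ → ℝ := fun x y => deriv (fun t => f t y) x

/-- Partial derivative in the second (`y`) variable. -/
def pdy (f : ℝ → ℝ → ℝ) : ℝ → ℝ → ℝ := fun x y => deriv (fun t => f x t) y

/-- Sharipov's pseudoinvariant `A = P₀₂ − 2Q₁₁ + R₂₀ + 2PS₁₀ + SP₁₀ − 3PR₀₁ − 3RP₀₁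
− 3QR₁₀ + 6QQ₀₁` of the ODE `y'' = P + 3Qy' + 3Ry'² + Sy'³`. -/
def shA (P Q R S : ℝ → ℝ → ℝ) : ℝ → ℝ → ℝ := fun x y =>
  pdy (pdy P) x y - 2 * pdx (pdy Q) x y + pdx (pdx R) x y
    + 2 * P x y * pdx S x y + S x y * pdx P x y - 3 * P x y * pdy R x y
    - 3 * R x y * pdy P x y - 3 * Q x y * pdx R x y + 6 * Q x y * pdy Q x y

/-- Sharipov's pseudoinvariant `B = S₂₀ − 2R₁₁ + Q₀₂ − 2SP₀₁ − PS₀₁ + 3SQ₁₀ + 3QS₁₀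
+ 3RQ₀₁ − 6RR₁₀`. -/
def shB (P Q R S : ℝ → ℝ → ℝ) : ℝ → ℝ → ℝ := fun x y =>
  pdx (pdx S) x y - 2 * pdx (pdy R) x y + pdy (pdy Q) x y
    - 2 * S x y * pdy P x y - P x y * pdy S x y + 3 * S x y * pdx Q x y
    + 3 * Q x y * pdx S x y + 3 * R x y * pdy Q x y - 6 * R x y * pdx R x y

/-- `G = −BB₁₀ − 3AB₀₁ + 4BA₀₁ + 3SA² − 6RBA + 3QB²`. -/
def shG (P Q R S : ℝ → ℝ → ℝ) : ℝ → ℝ → ℝ := fun x y =>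
  -(shB P Q R S x y) * pdx (shB P Q R S) x y - 3 * shA P Q R S x y * pdy (shB P Q R S) x y
    + 4 * shB P Q R S x y * pdy (shA P Q R S) x y + 3 * S x y * (shA P Q R S x y) ^ 2
    - 6 * R x y * shB P Q R S x y * shA P Q R S x y + 3 * Q x y * (shB P Q R S x y) ^ 2

/-- `H = −AA₀₁ − 3BA₁₀ + 4AB₁₀ − 3PB² + 6QAB − 3RA²`. -/
def shH (P Q R S : ℝ → ℝ → ℝ) : ℝ → ℝ → ℝ := fun x y =>
  -(shA P Q R S x y) * pdy (shA P Q R S) x y - 3 * shB P Q R S x y * pdx (shA P Q R S) x y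
    + 4 * shA P Q R S x y * pdx (shB P Q R S) x y - 3 * P x y * (shB P Q R S x y) ^ 2
    + 6 * Q x y * shA P Q R S x y * shB P Q R S x y - 3 * R x y * (shA P Q R S x y) ^ 2

/-- The coefficient `P = −2y² − xy − β²/(2y)` of the Painlevé 34 equation. -/
def P34 (β : ℝ) : ℝ → ℝ → ℝ := fun x y => -2 * y ^ 2 - x * y - β ^ 2 / (2 * y)

/-- The coefficient `Q = 0` of the Painlevé 34 equation. -/
def Q34 : ℝ → ℝ → ℝ := fun _ _ => 0

/-- The coefficient `R = 1/(6y)` of the Painlevé 34 equation. -/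
def R34 : ℝ → ℝ → ℝ := fun _ y => 1 / (6 * y)

/-- The coefficient `S = 0` of the Painlevé 34 equation. -/
def S34 : ℝ → ℝ → ℝ := fun _ _ => 0

/-- The case `A ≠ 0` pseudoinvariant `Ω`. -/
def shOmegaA (P Q R S : ℝ → ℝ → ℝ) : ℝ → ℝ → ℝ := fun x y =>
  let A := shA P Q R S x y
  let B := shB P Q R S x y
  let A10 := pdx (shA P Q R S) x y
  let A01 := pdy (shA P Q R S) x y
  let A20 := pdx (pdx (shA P Q R S)) x y
  let B10 := pdx (shB P Q R S) x y
  let B01 := pdy (shB P Q R S) x y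
  let B20 := pdx (pdx (shB P Q R S)) x y
  (2 * B * A10 * (B * P x y + A10) / A ^ 3
    - (2 * B10 + 3 * B * Q x y) * A10 / A ^ 2
    + (A01 - 2 * B10) * B * P x y / A ^ 2
    - (B * A20 + B ^ 2 * pdx P x y) / A ^ 2
    + B20 / A
    + (3 * B10 * Q x y + 3 * B * pdx Q x y - B01 * P x y - B * pdy P x y) / A
    + pdy Q x y - 2 * pdx R x y)

/-- The case `A ≠ 0` pseudoinvariant `N = −H/(3A)`. -/
def shN (P Q R S : ℝ → ℝ → ℝ) : ℝ → ℝ → ℝ := fun x y =>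
  -(shH P Q R S x y) / (3 * shA P Q R S x y)

/-- The case `A ≠ 0` pseudoinvariant `M`. -/
def shM (P Q R S : ℝ → ℝ → ℝ) : ℝ → ℝ → ℝ := fun x y =>
  let A := shA P Q R S x y
  let B := shB P Q R S x y
  let N := shN P Q R S x y
  let A10 := pdx (shA P Q R S) x y
  let A01 := pdy (shA P Q R S) x y
  let B10 := pdx (shB P Q R S) x y
  (-12 * B * N * (B * P x y + A10) / (5 * A) + (24 / 5) * B * N * Q x y
    + (6 / 5) * N * B10 + (6 / 5) * N * A01
    - A * pdy (shN P Q R S) x y + B * pdx (shN P Q R S) x y - (12 / 5) * A * N * R x y)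

theorem aux_pdy_eq {f : ℝ → ℝ → ℝ} {g : ℝ → ℝ} {x y d : ℝ}
    (h : ∀ᶠ t in nhds y, f x t = g t) (hd : HasDerivAt g d y) : pdy f x y = d := by
  have h' : (fun t => f x t) =ᶠ[nhds y] g := h
  exact (h'.deriv_eq).trans hd.deriv

theorem aux_inv (n : ℕ) {y : ℝ} (hy : y ≠ 0) :
    HasDerivAt (fun t : ℝ => (t ^ n)⁻¹) (-(n * y ^ (n - 1)) / (y ^ n) ^ 2) y :=
  (hasDerivAt_pow n y).fun_inv (pow_ne_zero n hy)

theorem aux_Py (β x : ℝ) {y : ℝ} (hy : y ≠ 0) :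
    pdy (P34 β) x y = -4 * y - x + β ^ 2 / 2 * (y ^ 2)⁻¹ := by
  refine aux_pdy_eq (g := fun t => -2 * t ^ 2 - x * t - β ^ 2 / 2 * (t ^ 1)⁻¹)
    (Filter.Eventually.of_forall fun t => ?_) ?_
  · simp only [P34, pow_one, div_eq_mul_inv, mul_inv]; ring
  · have := (((hasDerivAt_pow 2 y).const_mul (-2)).sub ((hasDerivAt_id y).const_mul x)).sub
      ((aux_inv 1 hy).const_mul (β ^ 2 / 2))
    refine this.congr_deriv ?_
    field_simp
    norm_num
    try ring

theorem aux_Pyy (β x : ℝ) {y : ℝ} (hy : y ≠ 0) :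
    pdy (pdy (P34 β)) x y = -4 - β ^ 2 * (y ^ 3)⁻¹ := by
  refine aux_pdy_eq (g := fun t => -4 * t - x + β ^ 2 / 2 * (t ^ 2)⁻¹)
    ((eventually_ne_nhds hy).mono fun t ht => aux_Py β x ht) ?_
  have := (((hasDerivAt_id y).const_mul (-4)).sub (hasDerivAt_const y x)).add
      ((aux_inv 2 hy).const_mul (β ^ 2 / 2))
  refine this.congr_deriv ?_
  field_simp
  norm_num
  try ring

theorem aux_Ry (x : ℝ) {y : ℝ} (hy : y ≠ 0) : pdy R34 x y = -(1 / 6) * (y ^ 2)⁻¹ := by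
  refine aux_pdy_eq (g := fun t => (1 / 6) * (t ^ 1)⁻¹)
    (Filter.Eventually.of_forall fun t => ?_) ?_
  · simp only [R34, pow_one, div_eq_mul_inv, mul_inv]; ring
  · refine ((aux_inv 1 hy).const_mul (1 / 6)).congr_deriv ?_
    field_simp
    norm_num

theorem aux_Rx : pdx R34 = fun _ _ => 0 := by
  funext x y; simp [pdx, R34]

theorem aux_Rxy : pdx (pdy R34) = fun _ _ => 0 := by
  funext x y; simp [pdx, pdy, R34]

theorem aux_0x : pdx (fun _ _ => (0 : ℝ)) = fun _ _ => 0 := by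
  funext x y; simp [pdx]

theorem aux_0y : pdy (fun _ _ => (0 : ℝ)) = fun _ _ => 0 := by
  funext x y; simp [pdy]

theorem aux_Q : Q34 = fun _ _ => 0 := rfl

theorem aux_S : S34 = fun _ _ => 0 := rfl

theorem aux_B (β : ℝ) : shB (P34 β) Q34 R34 S34 = fun _ _ => 0 := by
  funext x y
  simp [shB, aux_Q, aux_S, aux_0x, aux_0y, aux_Rx, aux_Rxy]

theorem aux_A (β x : ℝ) {y : ℝ} (hy : y ≠ 0) :
    shA (P34 β) Q34 R34 S34 x y = -3 - 3 * β ^ 2 / 2 * (y ^ 3)⁻¹ := by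
  simp only [shA, aux_Q, aux_S, aux_0x, aux_0y, aux_Rx, aux_Py β x hy, aux_Pyy β x hy,
    aux_Ry x hy]
  simp only [P34, R34]
  field_simp
  ring

theorem aux_Ay (β x : ℝ) {y : ℝ} (hy : y ≠ 0) :
    pdy (shA (P34 β) Q34 R34 S34) x y = 9 * β ^ 2 / 2 * (y ^ 4)⁻¹ := by
  refine aux_pdy_eq (g := fun t => -3 - 3 * β ^ 2 / 2 * (t ^ 3)⁻¹)
    ((eventually_ne_nhds hy).mono fun t ht => aux_A β x ht) ?_
  refine ((hasDerivAt_const y (-3 : ℝ)).sub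
    ((aux_inv 3 hy).const_mul (3 * β ^ 2 / 2))).congr_deriv ?_
  field_simp
  norm_num
  try ring

theorem aux_N (β x : ℝ) {y : ℝ} (hy : y ≠ 0) (hA : shA (P34 β) Q34 R34 S34 x y ≠ 0) :
    shN (P34 β) Q34 R34 S34 x y = 5 * β ^ 2 / 4 * (y ^ 4)⁻¹ - 1 / 2 * (y ^ 1)⁻¹ := by
  have e : shN (P34 β) Q34 R34 S34 x y =
      (pdy (shA (P34 β) Q34 R34 S34) x y + 3 * R34 x y * shA (P34 β) Q34 R34 S34 x y) / 3 := by
    simp only [shN, shH, aux_B, aux_0x]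
    field_simp
    ring
  rw [e, aux_Ay β x hy, aux_A β x hy]
  simp only [R34]
  field_simp
  ring

theorem aux_Ny (β x : ℝ) {y : ℝ} (hy : y ≠ 0) (hA : shA (P34 β) Q34 R34 S34 x y ≠ 0) :
    pdy (shN (P34 β) Q34 R34 S34) x y = -5 * β ^ 2 * (y ^ 5)⁻¹ + 1 / 2 * (y ^ 2)⁻¹ := by
  have hc : ContinuousAt (fun t : ℝ => -3 - 3 * β ^ 2 / 2 * (t ^ 3)⁻¹) y :=
    ((hasDerivAt_const y (-3 : ℝ)).sub
      ((aux_inv 3 hy).const_mul (3 * β ^ 2 / 2))).continuousAt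
  have hne := hc.eventually_ne (aux_A β x hy ▸ hA)
  refine aux_pdy_eq (g := fun t => 5 * β ^ 2 / 4 * (t ^ 4)⁻¹ - 1 / 2 * (t ^ 1)⁻¹)
    (((eventually_ne_nhds hy).and hne).mono fun t ht =>
      aux_N β x ht.1 (by rw [aux_A β x ht.1]; exact ht.2)) ?_
  refine (((aux_inv 4 hy).const_mul (5 * β ^ 2 / 4)).sub
    ((aux_inv 1 hy).const_mul (1 / 2))).congr_deriv ?_
  field_simp
  norm_num
  try ring

/-- for the Painlevé 34 equation, on the set where `y ≠ 0` and `A ≠ 0`,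
the case-`A ≠ 0` pseudoinvariants satisfy `Ω = 0`, `N = 5β²/(4y⁴) − 1/(2y)` and
`M = 9/(10y²) − 63β²/(4y⁵)`. -/
theorem painleve34_Omega_N_M (β x y : ℝ) (hy : y ≠ 0)
    (hA : shA (P34 β) Q34 R34 S34 x y ≠ 0) :
    shOmegaA (P34 β) Q34 R34 S34 x y = 0 ∧
    shN (P34 β) Q34 R34 S34 x y = 5 * β ^ 2 / (4 * y ^ 4) - 1 / (2 * y) ∧
    shM (P34 β) Q34 R34 S34 x y = 9 / (10 * y ^ 2) - 63 * β ^ 2 / (4 * y ^ 5) := by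
  refine ⟨?_, ?_, ?_⟩
  · simp only [shOmegaA, aux_B, aux_0x, aux_0y, aux_Rx]
    simp [aux_Q, aux_0y]
  · rw [aux_N β x hy hA]
    field_simp
  · simp only [shM, aux_B, aux_0x, aux_N β x hy hA, aux_Ny β x hy hA, aux_Ay β x hy,
      aux_A β x hy]
    simp only [R34, Q34]
    field_simp
    ring

end
end
end

section
/- Let β be a real constant and define f(y) = −(36/5)·y³·(35β² − 2y³)/(5β² − 2y³)² on the set D_β = {y > 0 : 5β² ≠ 2y³}. Then f is constant on D_β if and only if β = 0, and in that case f(y) = 18/5 for all y ∈ D_β. Equivalently, f(y) = 18/5 − 90β²(2y³ + β²)/(5β² − 2y³)² on D_β. -/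
/-- the invariant `I₁` of the Painlevé 34 equation, as a function
`f(y) = −(36/5)·y³(35β² − 2y³)/(5β² − 2y³)²` on `D_β = {y > 0 : 5β² ≠ 2y³}`, is constant
iff `β = 0`, in which case it equals `18/5`; equivalently
`f(y) = 18/5 − 90β²(2y³ + β²)/(5β² − 2y³)²` on `D_β`. -/
theorem painleve34_I1_constant_iff (β : ℝ) :
    let f : ℝ → ℝ := fun y => -(36 / 5) * y ^ 3 * (35 * β ^ 2 - 2 * y ^ 3)
      / (5 * β ^ 2 - 2 * y ^ 3) ^ 2
    let D : Set ℝ := {y | 0 < y ∧ 5 * β ^ 2 ≠ 2 * y ^ 3}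
    ((∃ c : ℝ, ∀ y ∈ D, f y = c) ↔ β = 0) ∧
    (β = 0 → ∀ y ∈ D, f y = 18 / 5) ∧
    (∀ y ∈ D, f y = 18 / 5 - 90 * β ^ 2 * (2 * y ^ 3 + β ^ 2)
      / (5 * β ^ 2 - 2 * y ^ 3) ^ 2) := by
  intro f D
  have key : ∀ y ∈ D, f y = 18 / 5 - 90 * β ^ 2 * (2 * y ^ 3 + β ^ 2)
      / (5 * β ^ 2 - 2 * y ^ 3) ^ 2 := by
    rintro y ⟨hy, hne⟩
    have h : 5 * β ^ 2 - 2 * y ^ 3 ≠ 0 := sub_ne_zero.mpr hne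
    simp only [f]
    have h2 : (5 * β ^ 2 - 2 * y ^ 3) ^ 2 ≠ 0 := pow_ne_zero 2 h
    rw [div_eq_iff h2, sub_mul, div_mul_cancel₀ _ h2]
    ring
  have zero : β = 0 → ∀ y ∈ D, f y = 18 / 5 := by
    intro hb y hy
    rw [key y hy, hb]
    simp
  refine ⟨⟨?_, fun hb => ⟨18 / 5, zero hb⟩⟩, zero, key⟩
  rintro ⟨c, hc⟩
  by_contra hb
  have hb2 : 0 < β ^ 2 := by positivity
  have root : ∀ t : ℝ, 0 < t → ∃ y : ℝ, 0 < y ∧ y ^ 3 = t := by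
    intro t ht
    refine ⟨t ^ ((1 : ℝ) / 3), by positivity, ?_⟩
    rw [← Real.rpow_natCast, ← Real.rpow_mul ht.le]
    norm_num
  obtain ⟨y, hy, hy3⟩ := root (β ^ 2) hb2
  obtain ⟨z, hz, hz3⟩ := root (35 / 2 * β ^ 2) (by positivity)
  have h1 := hc y ⟨hy, by rw [hy3]; intro h; linarith⟩
  have h2 := hc z ⟨hz, by rw [hz3]; intro h; linarith⟩
  simp only [f] at h1 h2
  rw [hy3] at h1
  rw [hz3] at h2
  have e2 : 35 * β ^ 2 - 2 * (35 / 2 * β ^ 2) = 0 := by ring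
  rw [e2, mul_zero, zero_div] at h2
  have e1 : 5 * β ^ 2 - 2 * β ^ 2 = 3 * β ^ 2 := by ring
  rw [e1, ← h2, div_eq_iff (by positivity)] at h1
  have h4 : 0 < β ^ 2 * β ^ 2 := by positivity
  nlinarith
end

section
/- Consider the Painlevé 34 equation with β = 0, i.e. coefficients P = −2y² − xy, Q = 0, R = 1/(6y), S = 0, for which A = −3, B = 0, Ω = 0, N = −1/(2y), M = 9/(10y²), γ¹ = −N_{0.1} − (12/5)NR, γ² = N_{1.0} − (6/5)N(−2y² − xy)/(−3)·0 + ... (the case A ≠ 0 formulas). Then on {(x,y) : y > 0}: (i) the invariant I₃ = Γ̂¹₂₂/M, where Γ̂¹₂₂ = [γ¹γ²(γ¹_{1.0} − γ²_{0.1}) + (γ²)²γ¹_{0.1} − (γ¹)²γ²_{1.0} + P(γ¹)³ + 3Q(γ¹)²γ² + 3Rγ¹(γ²)² + S(γ²)³]/M, equals (2y + x)/(30y); (ii) the invariant I₆ = (B·(I₃)_x − A·(I₃)_y)/N equals x/(5y); (iii) the invariant I₉ = (γ¹(I₃)_x + γ²(I₃)_y)²/N³ equals −1/(1250·y³); (iv)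 consequently the numerator 4 + 10I₆ − 60I₃ of the invariant J = (4 + 10I₆ − 60I₃)/(50√I₉) vanishes identically, so J = 0. -/
noncomputable section

/-- The coefficient `P = −2y² − xy` of the Painlevé 34 equation with `β = 0`. -/
def P340 : ℝ → ℝ → ℝ := fun x y => -2 * y ^ 2 - x * y

/-- The quantity `A = −3`. -/
def A340 : ℝ → ℝ → ℝ := fun _ _ => -3

/-- The quantity `B = 0`. -/
def B340 : ℝ → ℝ → ℝ := fun _ _ => 0

/-- The pseudoinvariant `Ω = 0`. -/
def Omega340 : ℝ → ℝ → ℝ := fun _ _ => 0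

/-- The pseudoinvariant `N = −1/(2y)`. -/
def N340 : ℝ → ℝ → ℝ := fun _ y => -1 / (2 * y)

/-- The pseudoinvariant `M = 9/(10y²)`. -/
def M340 : ℝ → ℝ → ℝ := fun _ y => 9 / (10 * y ^ 2)

/-- The component `γ¹` (case `A ≠ 0` formula). -/
def gamma1 : ℝ → ℝ → ℝ := fun x y =>
  (-6 * B340 x y * N340 x y * (B340 x y * P340 x y + pdx A340 x y) / (5 * (A340 x y) ^ 2)
    + 18 * N340 x y * B340 x y * Q34 x y / (5 * A340 x y)
    + 6 * N340 x y * (pdx B340 x y + pdy A340 x y) / (5 * A340 x y)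
    - pdy N340 x y - (12 / 5) * N340 x y * R34 x y - 2 * Omega340 x y * B340 x y)

/-- The component `γ²` (case `A ≠ 0` formula). -/
def gamma2 : ℝ → ℝ → ℝ := fun x y =>
  (-6 * N340 x y * (B340 x y * P340 x y + pdx A340 x y) / (5 * A340 x y)
    + pdx N340 x y + (6 / 5) * N340 x y * Q34 x y + 2 * Omega340 x y * A340 x y)

/-- The quantity `Γ̂¹₂₂`. -/
def Gamma122 : ℝ → ℝ → ℝ := fun x y =>
  (gamma1 x y * gamma2 x y * (pdx gamma1 x y - pdy gamma2 x y)
    + (gamma2 x y) ^ 2 * pdy gamma1 x y - (gamma1 x y) ^ 2 * pdx gamma2 x y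
    + P340 x y * (gamma1 x y) ^ 3 + 3 * Q34 x y * (gamma1 x y) ^ 2 * gamma2 x y
    + 3 * R34 x y * gamma1 x y * (gamma2 x y) ^ 2 + S34 x y * (gamma2 x y) ^ 3)
    / M340 x y

/-- The invariant `I₃ = Γ̂¹₂₂/M`. -/
def I3 : ℝ → ℝ → ℝ := fun x y => Gamma122 x y / M340 x y

/-- The invariant `I₆ = (B(I₃)ₓ − A(I₃)_y)/N`. -/
def I6 : ℝ → ℝ → ℝ := fun x y =>
  (B340 x y * pdx I3 x y - A340 x y * pdy I3 x y) / N340 x y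

/-- The invariant `I₉ = (γ¹(I₃)ₓ + γ²(I₃)_y)²/N³`. -/
def I9 : ℝ → ℝ → ℝ := fun x y =>
  (gamma1 x y * pdx I3 x y + gamma2 x y * pdy I3 x y) ^ 2 / (N340 x y) ^ 3

theorem aux_pdyN (x y : ℝ) : pdy N340 x y = 1 / (2 * y ^ 2) := by
  have h : (fun t : ℝ => N340 x t) = fun t => (-1 / 2) * t⁻¹ := by
    funext t
    simp only [N340, div_eq_mul_inv, mul_inv]
    ring
  unfold pdy
  rw [h, deriv_const_mul_field, deriv_inv]
  simp only [div_eq_mul_inv, mul_inv]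
  ring

theorem aux_g1 (x y : ℝ) : gamma1 x y = -3 / (10 * y ^ 2) := by
  unfold gamma1
  rw [aux_pdyN]
  simp only [pdx, pdy, A340, B340, N340, Q34, R34, Omega340, P340, deriv_const,
    div_eq_mul_inv, mul_inv]
  ring

theorem aux_g2 : gamma2 = fun _ _ => 0 := by
  funext x y
  simp [gamma2, pdx, A340, B340, N340, Q34, Omega340]

theorem aux_I3 (x y : ℝ) : I3 x y = (2 * y + x) / (30 * y) := by
  unfold I3 Gamma122
  rw [aux_g2]
  simp only [aux_g1, pdx, pdy, deriv_const, P340, Q34, R34, S34, M340]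
  rcases eq_or_ne y 0 with rfl | h
  · simp
  · field_simp
    ring

theorem aux_I3x (x y : ℝ) : pdx I3 x y = 1 / (30 * y) := by
  unfold pdx
  simp only [aux_I3]
  have h : HasDerivAt (fun t : ℝ => (2 * y + t) / (30 * y)) (1 / (30 * y)) x :=
    ((hasDerivAt_id x).const_add (2 * y)).div_const _
  exact h.deriv

theorem aux_I3y (x y : ℝ) (hy : y ≠ 0) : pdy I3 x y = - x / (30 * y ^ 2) := by
  unfold pdy
  simp only [aux_I3]
  have h := (((hasDerivAt_id y).const_mul 2).add_const x).div
    ((hasDerivAt_id y).const_mul 30) (by simpa using hy)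
  refine Eq.trans h.deriv ?_
  simp only [id]
  field_simp
  ring

/-- for the Painlevé 34 equation with `β = 0`, on `{y > 0}`:
`I₃ = (2y + x)/(30y)`, `I₆ = x/(5y)`, `I₉ = −1/(1250y³)`, the numerator
`4 + 10I₆ − 60I₃` of `J = (4 + 10I₆ − 60I₃)/(50√I₉)` vanishes, so `J = 0`. -/
theorem painleve34_beta0_I3_I6_I9_J (x y : ℝ) (hy : 0 < y) :
    I3 x y = (2 * y + x) / (30 * y) ∧
    I6 x y = x / (5 * y) ∧
    I9 x y = -1 / (1250 * y ^ 3) ∧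
    4 + 10 * I6 x y - 60 * I3 x y = 0 ∧
    (4 + 10 * I6 x y - 60 * I3 x y) / (50 * Real.sqrt (I9 x y)) = 0 := by
  have hy0 : y ≠ 0 := hy.ne'
  have h6 : I6 x y = x / (5 * y) := by
    unfold I6
    rw [aux_I3y x y hy0]
    simp only [A340, B340, N340]
    field_simp
    ring
  have h9 : I9 x y = -1 / (1250 * y ^ 3) := by
    unfold I9
    rw [aux_I3x, aux_g1, aux_g2]
    simp only [N340]
    field_simp
    ring
  have h0 : 4 + 10 * I6 x y - 60 * I3 x y = 0 := by
    rw [h6, aux_I3]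
    field_simp
    ring
  exact ⟨aux_I3 x y, h6, h9, h0, by rw [h0, zero_div]⟩

end
end

section
/- Let β ≠ 0 be a real constant and consider the scaled Painlevé 34 equation with coefficients P = −β²·y^{1/3}(6y + 3x·y^{2/3} + 3/2), Q = 0, R = 5/(18y), S = 0 on {(x,y) : y > 0}. With A, B, H, N, Ω, M, γ¹, γ², Γ̂¹₂₂ defined by Sharipov's explicit formulas (case A ≠ 0), the invariants satisfy, wherever the occurring denominators are nonzero: I₁ = M/N² = (36/5)·y(2y − 35)/(2y − 5)²; I₃ = Γ̂¹₂₂/M = y(4y + 2x·y^{2/3} + 1)(2y − 35)/(15(2y + 1)³); I₄ = (B(I₁)_x − A(I₁)_y)/N = −3240(2y + 7)·y·(2y + 1)/(2y − 5)⁴; and I₉ = (γ¹(I₃)_x + γ²(I₃)_y)²/N³ = −(64/625)·y⁶(2y − 35)⁴/(β²(2y + 1)⁸(2y − 5)³). -/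
noncomputable section

noncomputable section

/-- The component `γ¹` (case `A ≠ 0` formula). -/
def shGamma1 (P Q R S : ℝ → ℝ → ℝ) : ℝ → ℝ → ℝ := fun x y =>
  let A := shA P Q R S x y
  let B := shB P Q R S x y
  let N := shN P Q R S x y
  let A10 := pdx (shA P Q R S) x y
  let A01 := pdy (shA P Q R S) x y
  let B10 := pdx (shB P Q R S) x y
  (-6 * B * N * (B * P x y + A10) / (5 * A ^ 2) + 18 * N * B * Q x y / (5 * A)
    + 6 * N * (B10 + A01) / (5 * A)
    - pdy (shN P Q R S) x y - (12 / 5) * N * R x y - 2 * shOmegaA P Q R S x y * B)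

/-- The component `γ²` (case `A ≠ 0` formula). -/
def shGamma2 (P Q R S : ℝ → ℝ → ℝ) : ℝ → ℝ → ℝ := fun x y =>
  let A := shA P Q R S x y
  let B := shB P Q R S x y
  let N := shN P Q R S x y
  let A10 := pdx (shA P Q R S) x y
  (-6 * N * (B * P x y + A10) / (5 * A)
    + pdx (shN P Q R S) x y + (6 / 5) * N * Q x y + 2 * shOmegaA P Q R S x y * A)

/-- The quantity `Γ̂¹₂₂`. -/
def shGamma122 (P Q R S : ℝ → ℝ → ℝ) : ℝ → ℝ → ℝ := fun x y =>
  let g1 := shGamma1 P Q R S x y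
  let g2 := shGamma2 P Q R S x y
  (g1 * g2 * (pdx (shGamma1 P Q R S) x y - pdy (shGamma2 P Q R S) x y)
    + g2 ^ 2 * pdy (shGamma1 P Q R S) x y - g1 ^ 2 * pdx (shGamma2 P Q R S) x y
    + P x y * g1 ^ 3 + 3 * Q x y * g1 ^ 2 * g2 + 3 * R x y * g1 * g2 ^ 2 + S x y * g2 ^ 3)
    / shM P Q R S x y

/-- The invariant `I₁ = M/N²`. -/
def shI1 (P Q R S : ℝ → ℝ → ℝ) : ℝ → ℝ → ℝ := fun x y =>
  shM P Q R S x y / (shN P Q R S x y) ^ 2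

/-- The invariant `I₃ = Γ̂¹₂₂/M`. -/
def shI3 (P Q R S : ℝ → ℝ → ℝ) : ℝ → ℝ → ℝ := fun x y =>
  shGamma122 P Q R S x y / shM P Q R S x y

/-- The invariant `I₄ = (B(I₁)ₓ − A(I₁)_y)/N`. -/
def shI4 (P Q R S : ℝ → ℝ → ℝ) : ℝ → ℝ → ℝ := fun x y =>
  (shB P Q R S x y * pdx (shI1 P Q R S) x y - shA P Q R S x y * pdy (shI1 P Q R S) x y)
    / shN P Q R S x y

/-- The invariant `I₉ = (γ¹(I₃)ₓ + γ²(I₃)_y)²/N³`. -/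
def shI9 (P Q R S : ℝ → ℝ → ℝ) : ℝ → ℝ → ℝ := fun x y =>
  (shGamma1 P Q R S x y * pdx (shI3 P Q R S) x y
    + shGamma2 P Q R S x y * pdy (shI3 P Q R S) x y) ^ 2 / (shN P Q R S x y) ^ 3

/-- The coefficient `P = −β²y^{1/3}(6y + 3xy^{2/3} + 3/2)` of the scaled Painlevé 34
equation. -/
def P34s (β : ℝ) : ℝ → ℝ → ℝ := fun x y =>
  -β ^ 2 * y ^ ((1:ℝ)/3) * (6 * y + 3 * x * y ^ ((2:ℝ)/3) + 3 / 2)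

/-- The coefficient `Q = 0` of the scaled Painlevé 34 equation. -/
def Q34s : ℝ → ℝ → ℝ := fun _ _ => 0

/-- The coefficient `R = 5/(18y)` of the scaled Painlevé 34 equation. -/
def R34s : ℝ → ℝ → ℝ := fun _ y => 5 / (18 * y)

/-- The coefficient `S = 0` of the scaled Painlevé 34 equation. -/
def S34s : ℝ → ℝ → ℝ := fun _ _ => 0

def cb (y : ℝ) : ℝ := y ^ ((1:ℝ)/3)

lemma cb_pos {y : ℝ} (hy : 0 < y) : 0 < cb y := Real.rpow_pos_of_pos hy _

lemma cb_sq {y : ℝ} (hy : 0 < y) : y ^ ((2:ℝ)/3) = cb y ^ 2 := by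
  unfold cb
  rw [← Real.rpow_natCast, ← Real.rpow_mul hy.le]; norm_num

lemma cb_cube {y : ℝ} (hy : 0 < y) : cb y ^ 3 = y := by
  unfold cb
  rw [← Real.rpow_natCast, ← Real.rpow_mul hy.le]; norm_num

lemma cb_deriv {y : ℝ} (hy : 0 < y) : HasDerivAt cb (cb y / (3 * y)) y := by
  have h := Real.hasDerivAt_rpow_const (x := y) (p := (1:ℝ)/3) (Or.inl hy.ne')
  refine h.congr_deriv ?_
  rw [Real.rpow_sub_one hy.ne']; unfold cb; field_simp

lemma pdy_eq {f : ℝ → ℝ → ℝ} {x y d : ℝ} (g : ℝ → ℝ) (hy : 0 < y)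
    (h : ∀ t, 0 < t → f x t = g t) (hd : HasDerivAt g d y) : pdy f x y = d := by
  have : (fun t => f x t) =ᶠ[nhds y] g := by
    filter_upwards [lt_mem_nhds hy] with t ht using h t ht
  unfold pdy
  rw [this.deriv_eq, hd.deriv]

lemma pdx_zero {f : ℝ → ℝ → ℝ} {x y : ℝ} (c : ℝ) (h : ∀ t, f t y = c) : pdx f x y = 0 := by
  unfold pdx
  simp [h]

lemma cP (β x : ℝ) {y : ℝ} (hy : 0 < y) :
    P34s β x y = -β ^ 2 * (6 * y * cb y + 3 * x * y + 3 / 2 * cb y) := by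
  unfold P34s
  rw [cb_sq hy]
  change -β ^ 2 * cb y * _ = _
  linear_combination (-β ^ 2 * 3 * x) * cb_cube hy

lemma cPy (β x : ℝ) {y : ℝ} (hy : 0 < y) :
    pdy (P34s β) x y = -β ^ 2 * (8 * cb y + 3 * x + cb y / (2 * y)) := by
  refine pdy_eq (fun y => -β ^ 2 * (6 * y * cb y + 3 * x * y + 3 / 2 * cb y)) hy
    (fun t ht => cP β x ht) ?_
  have hc := cb_deriv hy
  have hi := hasDerivAt_id' y
  refine HasDerivAt.congr_deriv (((((hi.const_mul 6).mul hc).add (hi.const_mul (3 * x))).add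
    (hc.const_mul (3 / 2))).const_mul (-β ^ 2)) ?_
  field_simp
  ring

lemma cPyy (β x : ℝ) {y : ℝ} (hy : 0 < y) :
    pdy (pdy (P34s β)) x y = -β ^ 2 * (8 * cb y / (3 * y) - cb y / (3 * y ^ 2)) := by
  refine pdy_eq (fun y => -β ^ 2 * (8 * cb y + 3 * x + cb y / (2 * y))) hy
    (fun t ht => cPy β x ht) ?_
  have hc := cb_deriv hy
  have hi := hasDerivAt_id' y
  refine HasDerivAt.congr_deriv ((((hc.const_mul 8).add_const (3 * x)).add
    (hc.div (hi.const_mul 2) (by positivity))).const_mul (-β ^ 2)) ?_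
  field_simp
  ring

lemma cRy (x : ℝ) {y : ℝ} (hy : 0 < y) : pdy R34s x y = -5 / (18 * y ^ 2) := by
  refine pdy_eq (fun y => 5 / (18 * y)) hy (fun t ht => rfl) ?_
  have hi := hasDerivAt_id' y
  refine HasDerivAt.congr_deriv ((hasDerivAt_const y (5:ℝ)).div (hi.const_mul 18) (by positivity)) ?_
  field_simp
  ring

lemma cRx (x y : ℝ) : pdx R34s x y = 0 := by simp [pdx, R34s]
lemma cRxx (x y : ℝ) : pdx (pdx R34s) x y = 0 := by simp [pdx, R34s]
lemma cRxy (x y : ℝ) : pdx (pdy R34s) x y = 0 := by simp [pdx, pdy, R34s]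

lemma cA (β x : ℝ) {y : ℝ} (hy : 0 < y) :
    shA (P34s β) Q34s R34s S34s x y = -β ^ 2 * (2 * y + 1) * cb y / (2 * y ^ 2) := by
  unfold shA
  rw [cPyy β x hy, cPy β x hy, cRy x hy, cRxx, cP β x hy]
  simp only [pdx, pdy, Q34s, S34s, R34s, deriv_const]
  field_simp
  ring

lemma cB (β x y : ℝ) : shB (P34s β) Q34s R34s S34s x y = 0 := by
  unfold shB
  rw [cRxy, cRx]
  simp [pdx, pdy, Q34s, S34s]

lemma cBf (β : ℝ) : shB (P34s β) Q34s R34s S34s = fun _ _ => 0 := by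
  funext x y; exact cB β x y

lemma cAx (β x : ℝ) {y : ℝ} (hy : 0 < y) : pdx (shA (P34s β) Q34s R34s S34s) x y = 0 :=
  pdx_zero _ (fun t => cA β t hy)

lemma cAy (β x : ℝ) {y : ℝ} (hy : 0 < y) : pdy (shA (P34s β) Q34s R34s S34s) x y =
    β ^ 2 * (4 * y + 5) * cb y / (6 * y ^ 3) := by
  refine pdy_eq _ hy (fun t ht => cA β x ht) ?_
  have hc := cb_deriv hy
  have hi := hasDerivAt_id' y
  refine HasDerivAt.congr_deriv ((((((hi.const_mul 2).add_const 1).const_mul (-β ^ 2)).mul hc).div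
    ((hi.pow 2).const_mul 2) (show 2 * y ^ 2 ≠ 0 by positivity))) ?_
  simp only [Pi.mul_apply]
  field_simp
  ring

lemma cN (β x : ℝ) (hβ : β ≠ 0) {y : ℝ} (hy : 0 < y) :
    shN (P34s β) Q34s R34s S34s x y = -β ^ 2 * (2 * y - 5) * cb y / (36 * y ^ 3) := by
  have h0 := (cb_pos hy).ne'
  have h1 : 2 * y + 1 ≠ 0 := by positivity
  unfold shN shH
  rw [cAy β x hy, cAx β x hy, cA β x hy, cBf]
  simp only [pdx, Q34s, R34s, deriv_const]
  field_simp
  ring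

lemma cNx (β x : ℝ) (hβ : β ≠ 0) {y : ℝ} (hy : 0 < y) :
    pdx (shN (P34s β) Q34s R34s S34s) x y = 0 :=
  pdx_zero _ (fun t => cN β t hβ hy)

lemma cNy (β x : ℝ) (hβ : β ≠ 0) {y : ℝ} (hy : 0 < y) :
    pdy (shN (P34s β) Q34s R34s S34s) x y =
    -β ^ 2 * cb y * (40 - 10 * y) / (108 * y ^ 4) := by
  refine pdy_eq _ hy (fun t ht => cN β x hβ ht) ?_
  have hc := cb_deriv hy
  have hi := hasDerivAt_id' y
  refine HasDerivAt.congr_deriv ((((((hi.const_mul 2).sub_const 5).const_mul (-β ^ 2)).mul hc).div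
    ((hi.pow 3).const_mul 36) (show 36 * y ^ 3 ≠ 0 by positivity))) ?_
  simp only [Pi.mul_apply]
  field_simp
  ring

lemma cM (β x : ℝ) (hβ : β ≠ 0) {y : ℝ} (hy : 0 < y) :
    shM (P34s β) Q34s R34s S34s x y = β ^ 4 * cb y ^ 2 * (2 * y - 35) / (180 * y ^ 5) := by
  have h0 := (cb_pos hy).ne'
  have h1 : 2 * y + 1 ≠ 0 := by positivity
  unfold shM
  simp only
  rw [cNy β x hβ hy, cNx β x hβ hy, cN β x hβ hy, cAy β x hy, cAx β x hy, cA β x hy, cBf]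
  simp only [pdx, Q34s, R34s, deriv_const]
  field_simp
  ring

lemma cOm (β x : ℝ) {y : ℝ} (hy : 0 < y) : shOmegaA (P34s β) Q34s R34s S34s x y = 0 := by
  unfold shOmegaA
  simp only
  rw [cBf, cRx, cAx β x hy]
  simp [pdx, pdy, Q34s]

lemma cG1 (β x : ℝ) (hβ : β ≠ 0) {y : ℝ} (hy : 0 < y) :
    shGamma1 (P34s β) Q34s R34s S34s x y
      = -β ^ 2 * cb y * (2 * y - 35) / (90 * y ^ 3 * (2 * y + 1)) := by
  have h0 := (cb_pos hy).ne'
  have h1 : 2 * y + 1 ≠ 0 := by positivity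
  unfold shGamma1
  simp only
  rw [cNy β x hβ hy, cN β x hβ hy, cAy β x hy, cAx β x hy, cA β x hy, cBf, cOm β x hy]
  simp only [pdx, Q34s, R34s, deriv_const]
  field_simp
  ring

lemma cG2 (β x : ℝ) (hβ : β ≠ 0) {y : ℝ} (hy : 0 < y) :
    shGamma2 (P34s β) Q34s R34s S34s x y = 0 := by
  unfold shGamma2
  simp only
  rw [cNx β x hβ hy, cAx β x hy, cBf, cOm β x hy]
  simp [Q34s]

lemma cI1 (β x : ℝ) (hβ : β ≠ 0) {y : ℝ} (hy : 0 < y) :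
    shI1 (P34s β) Q34s R34s S34s x y = (36 / 5) * y * (2 * y - 35) / (2 * y - 5) ^ 2 := by
  have h0 := (cb_pos hy).ne'
  unfold shI1
  rw [cM β x hβ hy, cN β x hβ hy]
  by_cases h5 : 2 * y - 5 = 0
  · simp [h5]
  field_simp
  ring

lemma cI3 (β x : ℝ) (hβ : β ≠ 0) {y : ℝ} (hy : 0 < y) :
    shI3 (P34s β) Q34s R34s S34s x y
      = y * (4 * y + 2 * x * y ^ ((2:ℝ)/3) + 1) * (2 * y - 35) / (15 * (2 * y + 1) ^ 3) := by
  have h0 := (cb_pos hy).ne'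
  have h1 : 2 * y + 1 ≠ 0 := by positivity
  unfold shI3 shGamma122
  simp only
  rw [pdx_zero (f := shGamma2 _ _ _ _) 0 (fun t => cG2 β t hβ hy), cM β x hβ hy, cG2 β x hβ hy,
    cG1 β x hβ hy]
  by_cases h5 : 2 * y - 35 = 0
  · simp [h5]
  replace h5 : 2 * y - 35 ≠ 0 := h5
  unfold P34s
  rw [cb_sq hy]
  change (_ + -β ^ 2 * cb y * _ * _ + _ + _ + _) / _ / _ = _
  have h3 := cb_cube hy
  generalize cb y = c at *
  subst h3
  generalize 2 * c ^ 3 - 35 = k at *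
  simp only [mul_zero, zero_mul, sub_zero, add_zero, zero_add, zero_pow two_ne_zero]
  field_simp
  ring

/-- the invariants of the scaled Painlevé 34 equation (`β ≠ 0`), computed
by Sharipov's case-`A ≠ 0` formulas, satisfy `I₁ = (36/5)y(2y−35)/(2y−5)²`,
`I₃ = y(4y + 2xy^{2/3} + 1)(2y−35)/(15(2y+1)³)`, `I₄ = −3240(2y+7)y(2y+1)/(2y−5)⁴`,
`I₉ = −(64/625)y⁶(2y−35)⁴/(β²(2y+1)⁸(2y−5)³)` wherever the occurring denominators are
nonzero. -/
theorem scaled_painleve34_invariants (β x y : ℝ) (hβ : β ≠ 0) (hy : 0 < y)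
    (hA : shA (P34s β) Q34s R34s S34s x y ≠ 0)
    (hN : shN (P34s β) Q34s R34s S34s x y ≠ 0)
    (hM : shM (P34s β) Q34s R34s S34s x y ≠ 0)
    (h5 : 2 * y - 5 ≠ 0) (h1 : 2 * y + 1 ≠ 0) :
    shI1 (P34s β) Q34s R34s S34s x y = (36 / 5) * y * (2 * y - 35) / (2 * y - 5) ^ 2 ∧
    shI3 (P34s β) Q34s R34s S34s x y
      = y * (4 * y + 2 * x * y ^ ((2:ℝ)/3) + 1) * (2 * y - 35) / (15 * (2 * y + 1) ^ 3) ∧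
    shI4 (P34s β) Q34s R34s S34s x y
      = -3240 * (2 * y + 7) * y * (2 * y + 1) / (2 * y - 5) ^ 4 ∧
    shI9 (P34s β) Q34s R34s S34s x y
      = -(64 / 625) * y ^ 6 * (2 * y - 35) ^ 4
        / (β ^ 2 * (2 * y + 1) ^ 8 * (2 * y - 5) ^ 3) := by
  have h0 := (cb_pos hy).ne'
  refine ⟨cI1 β x hβ hy, cI3 β x hβ hy, ?_, ?_⟩
  · unfold shI4
    have hd : pdy (shI1 (P34s β) Q34s R34s S34s) x y = 180 * (2 * y + 7) / (2 * y - 5) ^ 3 := by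
      refine pdy_eq _ hy (fun t ht => cI1 β x hβ ht) ?_
      have hi := hasDerivAt_id' y
      refine HasDerivAt.congr_deriv ((((hi.const_mul (36 / 5)).mul ((hi.const_mul 2).sub_const 35)).div
        (((hi.const_mul 2).sub_const 5).pow 2) (pow_ne_zero 2 h5))) ?_
      simp only [Pi.mul_apply, Pi.pow_apply]
      field_simp
      ring
    rw [hd, cB, cA β x hy, cN β x hβ hy]
    field_simp
    ring
  · unfold shI9
    have hd : pdx (shI3 (P34s β) Q34s R34s S34s) x y
        = y * (2 * cb y ^ 2) * (2 * y - 35) / (15 * (2 * y + 1) ^ 3) := by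
      unfold pdx
      simp only [cI3 β _ hβ hy, cb_sq hy]
      have hi := hasDerivAt_id' x
      refine HasDerivAt.deriv ?_
      refine HasDerivAt.congr_deriv (((((((hi.const_mul 2).mul_const (cb y ^ 2)).const_add (4 * y)).add_const 1).const_mul
        y).mul_const (2 * y - 35)).div_const (15 * (2 * y + 1) ^ 3)) ?_
      ring
    rw [hd, cG2 β x hβ hy, cG1 β x hβ hy, cN β x hβ hy]
    have h3 := cb_cube hy
    generalize cb y = c at *
    subst h3
    field_simp
    ring

end
end
end

section
/- For every real y with 2y − 5 ≠ 0, set I₁ = (36/5)·y(2y − 35)/(2y − 5)² and I₄ = −3240·(2y + 7)·y·(2y + 1)/(2y − 5)⁴, and let D = 2·(−1469664 + 1250·I₄·I₁ − 13875·I₄ + 691470·I₁ − 90825·I₁² + 3375·I₁³). Then whenever D ≠ 0, one has y = 125·(2322·I₁ + 3·I₄ + 20·I₄·I₁ − 915·I₁² + 75·I₁³)/D. -/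
/-- recovery of the coordinate `y` from the invariants `I₁`, `I₄` of the
scaled Painlevé 34 equation (next-to-last step of Buchberger's algorithm). -/
theorem painleve34_recover_y (y I1 I4 D : ℝ) (hy : 2 * y - 5 ≠ 0)
    (hI1 : I1 = (36 / 5) * y * (2 * y - 35) / (2 * y - 5) ^ 2)
    (hI4 : I4 = -3240 * (2 * y + 7) * y * (2 * y + 1) / (2 * y - 5) ^ 4)
    (hD : D = 2 * (-1469664 + 1250 * I4 * I1 - 13875 * I4 + 691470 * I1
      - 90825 * I1 ^ 2 + 3375 * I1 ^ 3))
    (hD0 : D ≠ 0) :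
    y = 125 * (2322 * I1 + 3 * I4 + 20 * I4 * I1 - 915 * I1 ^ 2 + 75 * I1 ^ 3) / D := by
  rw [eq_div_iff hD0, hD, hI1, hI4]
  clear hI1 hI4 hD hD0
  obtain ⟨t, ht⟩ : ∃ t, t = 2 * y - 5 := ⟨_, rfl⟩
  rw [← ht] at hy ⊢
  have hy2 : y = (t + 5) / 2 := by linarith
  subst hy2
  clear ht
  field_simp
  ring
end
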